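/- Fix s ∈ ℍ. At every q ∈ ℍ with Q_{c,s}(q) ≠ 0 one has D(Q_{c,s}(·)^{−1})(q) = 2(s−q)(s² − 2Re(q)s + |q|²)^{−2}, and consequently applying the Fueter operator twice to the left slice hyperholomorphic Cauchy kernel gives D²S_L^{−1}(s,q) = −4(s−q)(s² − 2Re(q)s + |q|²)^{−2} = F_L(s, q̄). -/

import Mathlib

noncomputable section

open Quaternion Finset

def e1 : Quaternion ℝ := ⟨0, 1, 0, 0⟩
def e2 : Quaternion ℝ := ⟨0, 0, 1, 0⟩
def e3 : Quaternion ℝ := ⟨0, 0, 0, 1⟩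

/-- Left Fueter operator `Df = ∂₀f + e₁∂₁f + e₂∂₂f + e₃∂₃f` (real directional derivatives
along `1, e₁, e₂, e₃`). -/
def fueterL (f : Quaternion ℝ → Quaternion ℝ) (q : Quaternion ℝ) : Quaternion ℝ :=
  fderiv ℝ f q 1 + e1 * fderiv ℝ f q e1 + e2 * fderiv ℝ f q e2 + e3 * fderiv ℝ f q e3

/-- Right Fueter operator `fD = ∂₀f + (∂₁f)e₁ + (∂₂f)e₂ + (∂₃f)e₃`. -/
def fueterR (f : Quaternion ℝ → Quaternion ℝ) (q : Quaternion ℝ) : Quaternion ℝ :=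
  fderiv ℝ f q 1 + fderiv ℝ f q e1 * e1 + fderiv ℝ f q e2 * e2 + fderiv ℝ f q e3 * e3

/-- Second directional derivative along `v`. -/
def dir2 (f : Quaternion ℝ → Quaternion ℝ) (v q : Quaternion ℝ) : Quaternion ℝ :=
  fderiv ℝ (fun x => fderiv ℝ f x v) q v

/-- Laplacian in the four real coordinates of a quaternionic variable. -/
def quatLaplacian (f : Quaternion ℝ → Quaternion ℝ) (q : Quaternion ℝ) : Quaternion ℝ :=
  dir2 f 1 q + dir2 f e1 q + dir2 f e2 q + dir2 f e3 q

/-- `Q_{c,s}(q) = s² − 2 Re(q) s + |q|²` (commutative pseudo Cauchy kernel denominator). -/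
def Qcs (s q : Quaternion ℝ) : Quaternion ℝ :=
  s ^ 2 - 2 * (q.re : Quaternion ℝ) * s + ((‖q‖ ^ 2 : ℝ) : Quaternion ℝ)

/-- Left slice hyperholomorphic Cauchy kernel `S_L⁻¹(s,q) = (s − q̄) Q_{c,s}(q)⁻¹` (form II). -/
def SL (s q : Quaternion ℝ) : Quaternion ℝ := (s - star q) * (Qcs s q)⁻¹

/-- Right slice hyperholomorphic Cauchy kernel `S_R⁻¹(s,q) = Q_{c,s}(q)⁻¹ (s − q̄)` (form II). -/
def SR (s q : Quaternion ℝ) : Quaternion ℝ := (Qcs s q)⁻¹ * (s - star q)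

/-- Left F-kernel `F_L(s,q) = −4 (s − q̄) Q_{c,s}(q)⁻²`. -/
def FL (s q : Quaternion ℝ) : Quaternion ℝ := -4 * (s - star q) * ((Qcs s q) ^ 2)⁻¹

/-- Right F-kernel `F_R(s,q) = −4 Q_{c,s}(q)⁻² (s − q̄)`. -/
def FR (s q : Quaternion ℝ) : Quaternion ℝ := -4 * ((Qcs s q) ^ 2)⁻¹ * (s - star q)

theorem e1_components : e1.re = 0 ∧ e1.imI = 1 ∧ e1.imJ = 0 ∧ e1.imK = 0 :=
  ⟨rfl, rfl, rfl, rfl⟩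

theorem e2_components : e2.re = 0 ∧ e2.imI = 0 ∧ e2.imJ = 1 ∧ e2.imK = 0 :=
  ⟨rfl, rfl, rfl, rfl⟩

theorem e3_components : e3.re = 0 ∧ e3.imI = 0 ∧ e3.imJ = 0 ∧ e3.imK = 1 :=
  ⟨rfl, rfl, rfl, rfl⟩

theorem Qcs_eq_smul (s q : Quaternion ℝ) :
    Qcs s q = s ^ 2 - (2 * q.re) • s + (‖q‖ ^ 2) • (1 : Quaternion ℝ) := by
  rw [Qcs, mul_assoc, two_mul, Quaternion.coe_mul_eq_smul, ← add_smul, ← two_mul,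
    Algebra.smul_def _ (1 : Quaternion ℝ), mul_one]
  rfl

/-- The real derivative of `Qcs s` at `q`. -/
def fderivQcs (s q : Quaternion ℝ) : Quaternion ℝ →L[ℝ] Quaternion ℝ :=
  (2 • innerSL ℝ q).smulRight 1 - (2 • innerSL ℝ (1 : Quaternion ℝ)).smulRight s

theorem fderivQcs_apply (s q v : Quaternion ℝ) :
    fderivQcs s q v = (2 * (q * star v).re) • (1 : Quaternion ℝ) - (2 * v.re) • s := by
  simp only [fderivQcs, sub_apply, ContinuousLinearMap.smulRight_apply,
    smul_apply, innerSL_apply_apply, Quaternion.inner_def, one_mul,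
    Quaternion.re_star, nsmul_eq_mul, Nat.cast_ofNat]

theorem hasFDerivAt_Qcs (s q : Quaternion ℝ) : HasFDerivAt (Qcs s) (fderivQcs s q) q := by
  have h1 : HasFDerivAt (fun x : Quaternion ℝ => ‖x‖ ^ 2) (2 • innerSL ℝ q) q :=
    (hasStrictFDerivAt_norm_sq q).hasFDerivAt
  have h2 := (2 • innerSL ℝ (1 : Quaternion ℝ)).hasFDerivAt (x := q)
  have h3 := ((h1.smul_const (1 : Quaternion ℝ)).sub (h2.smul_const s)).const_add (s ^ 2)
  have h4 : Qcs s = fun x => s ^ 2 + (‖x‖ ^ 2 • (1 : Quaternion ℝ)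
      - (2 • innerSL ℝ (1 : Quaternion ℝ)) x • s) := by
    funext x
    simp only [Qcs_eq_smul, smul_apply, innerSL_apply_apply,
      Quaternion.inner_def, one_mul, Quaternion.re_star, nsmul_eq_mul, Nat.cast_ofNat]
    abel
  rw [h4]
  exact h3

theorem commute_fderivQcs_inv (s q v : Quaternion ℝ) :
    Commute (fderivQcs s q v) (Qcs s q)⁻¹ := by
  have h : Commute s (Qcs s q) := by
    rw [Qcs_eq_smul]
    exact (((Commute.refl s).pow_right 2).sub_right ((Commute.refl s).smul_right _)).add_right
      ((Commute.one_right s).smul_right _)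
  rw [fderivQcs_apply]
  exact ((Commute.one_left _).smul_left _).sub_left (h.inv_right₀.smul_left _)

theorem hasFDerivAt_Qcs_inv {s q : Quaternion ℝ} (h : Qcs s q ≠ 0) :
    HasFDerivAt (fun x => (Qcs s x)⁻¹)
      ((-ContinuousLinearMap.mulLeftRight ℝ (Quaternion ℝ) (Qcs s q)⁻¹ (Qcs s q)⁻¹).comp
        (fderivQcs s q)) q :=
  (hasFDerivAt_inv' h).comp q (hasFDerivAt_Qcs s q)

theorem fderiv_Qcs_inv {s q : Quaternion ℝ} (h : Qcs s q ≠ 0) (v : Quaternion ℝ) :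
    fderiv ℝ (fun x => (Qcs s x)⁻¹) q v = -(fderivQcs s q v * ((Qcs s q)⁻¹ * (Qcs s q)⁻¹)) := by
  rw [(hasFDerivAt_Qcs_inv h).fderiv]
  simp only [ContinuousLinearMap.comp_apply, neg_apply,
    ContinuousLinearMap.mulLeftRight_apply]
  rw [← (commute_fderivQcs_inv s q v).eq, mul_assoc]

theorem fderiv_SL {s q : Quaternion ℝ} (h : Qcs s q ≠ 0) (v : Quaternion ℝ) :
    fderiv ℝ (SL s) q v = -((s - star q) * fderivQcs s q v * ((Qcs s q)⁻¹ * (Qcs s q)⁻¹))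
      - star v * (Qcs s q)⁻¹ := by
  have : StarModule ℝ (Quaternion ℝ) := ⟨fun r x => by ext <;> simp⟩
  have h1 : HasFDerivAt (fun x : Quaternion ℝ => s - star x) _ q :=
    (hasFDerivAt_id (𝕜 := ℝ) q).star.const_sub s
  have h2 : HasFDerivAt (SL s) _ q := h1.mul' (hasFDerivAt_Qcs_inv h)
  have h3 := fderiv_Qcs_inv h v
  rw [(hasFDerivAt_Qcs_inv h).fderiv] at h3
  rw [h2.fderiv, add_apply, smul_apply, h3]
  simp [mul_assoc, sub_eq_add_neg]

theorem fueterL_Qcs_inv {s q : Quaternion ℝ} (h : Qcs s q ≠ 0) :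
    fueterL (fun x => (Qcs s x)⁻¹) q = 2 * (s - q) * ((Qcs s q) ^ 2)⁻¹ := by
  have key : -(fderivQcs s q 1 + e1 * fderivQcs s q e1 + e2 * fderivQcs s q e2
      + e3 * fderivQcs s q e3) = 2 * (s - q) := by
    simp only [fderivQcs_apply, two_mul (s - q)]
    ext <;> simp [e1_components, e2_components, e3_components] <;> ring
  rw [← key, pow_two, mul_inv_rev]
  simp only [fueterL, fderiv_Qcs_inv h]
  noncomm_ring

theorem fueterL_SL {s q : Quaternion ℝ} (h : Qcs s q ≠ 0) :
    fueterL (SL s) q = (-2 : ℝ) • (Qcs s q)⁻¹ := by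
  have key : (s - star q) * fderivQcs s q 1 + e1 * ((s - star q) * fderivQcs s q e1)
      + e2 * ((s - star q) * fderivQcs s q e2) + e3 * ((s - star q) * fderivQcs s q e3)
      = (-2 : ℝ) • Qcs s q := by
    have hn : ‖q‖ ^ 2 = q.re ^ 2 + q.imI ^ 2 + q.imJ ^ 2 + q.imK ^ 2 := by
      rw [pow_two, ← Quaternion.normSq_eq_norm_mul_self, Quaternion.normSq_def']
    simp only [fderivQcs_apply, Qcs_eq_smul, hn]
    ext <;> simp [e1_components, e2_components, e3_components, pow_two] <;> ring
  have hstar : star 1 + e1 * star e1 + e2 * star e2 + e3 * star e3 = (4 : ℝ) • 1 := by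
    ext <;> simp [e1_components, e2_components, e3_components]; norm_num
  have hP : Qcs s q * ((Qcs s q)⁻¹ * (Qcs s q)⁻¹) = (Qcs s q)⁻¹ := mul_inv_cancel_left₀ h _
  calc fueterL (SL s) q
      = -(((s - star q) * fderivQcs s q 1 + e1 * ((s - star q) * fderivQcs s q e1)
          + e2 * ((s - star q) * fderivQcs s q e2) + e3 * ((s - star q) * fderivQcs s q e3))
            * ((Qcs s q)⁻¹ * (Qcs s q)⁻¹))
        - (star 1 + e1 * star e1 + e2 * star e2 + e3 * star e3) * (Qcs s q)⁻¹ := by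
        simp only [fueterL, fderiv_SL h]
        noncomm_ring
    _ = (-2 : ℝ) • (Qcs s q)⁻¹ := by
        rw [key, hstar, smul_mul_assoc, hP, smul_mul_assoc, one_mul]
        module

theorem fueterL_congr {f g : Quaternion ℝ → Quaternion ℝ} {q : Quaternion ℝ}
    (h : f =ᶠ[nhds q] g) : fueterL f q = fueterL g q := by
  simp only [fueterL, h.fderiv_eq]

theorem fueterL_const_smul {f : Quaternion ℝ → Quaternion ℝ} {q : Quaternion ℝ}
    (hf : DifferentiableAt ℝ f q) (c : ℝ) :
    fueterL (fun x => c • f x) q = c • fueterL f q := by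
  simp only [fueterL, fderiv_fun_const_smul hf, smul_apply, mul_smul_comm,
    smul_add]

/-- `D(Q_{c,s}(·)⁻¹)(q) = 2(s−q)(s² − 2Re(q)s + |q|²)⁻²`, and consequently
`D² S_L⁻¹(s,q) = −4(s−q)(s² − 2Re(q)s + |q|²)⁻² = F_L(s, q̄)`. -/
theorem fueter_sq_cauchyKernel (s q : Quaternion ℝ) (h : Qcs s q ≠ 0) :
    fueterL (fun x => (Qcs s x)⁻¹) q = 2 * (s - q) * ((Qcs s q) ^ 2)⁻¹ ∧
    fueterL (fun x => fueterL (fun y => SL s y) x) q = -4 * (s - q) * ((Qcs s q) ^ 2)⁻¹ ∧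
    fueterL (fun x => fueterL (fun y => SL s y) x) q = FL s (star q) := by
  have hsq : fueterL (fun x => fueterL (fun y => SL s y) x) q
      = -4 * (s - q) * ((Qcs s q) ^ 2)⁻¹ := by
    have hev : (fun x => fueterL (fun y => SL s y) x)
        =ᶠ[nhds q] fun x => (-2 : ℝ) • (Qcs s x)⁻¹ := by
      filter_upwards [(hasFDerivAt_Qcs s q).continuousAt.eventually_ne h] with x hx
      exact fueterL_SL hx
    rw [fueterL_congr hev, fueterL_const_smul (hasFDerivAt_Qcs_inv h).differentiableAt,
      fueterL_Qcs_inv h, ← smul_mul_assoc]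
    congr 1
    rw [two_mul, neg_mul, show (4 : Quaternion ℝ) = 2 + 2 by norm_num, add_mul, two_mul]
    module
  refine ⟨fueterL_Qcs_inv h, hsq, ?_⟩
  have hstar : Qcs s (star q) = Qcs s q := by simp [Qcs]
  rw [hsq, FL, hstar, star_star]
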